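/- For every integer k >= 1, the words X^k Y X^{-k}, X^k Y^{-1} X^{-k}, X^{-k} Y X^k and X^{-k} Y^{-1} X^k are primitive disk words lying in the domain of the basepoint-counting function P, and P(X^k Y X^{-k}) = (0,-1), P(X^k Y^{-1} X^{-k}) = (0,1), P(X^{-k} Y X^k) = (1,0), P(X^{-k} Y^{-1} X^k) = (-1,0). In particular P(X^k Y X^{-k}) = P(X Y X^{-1}), and similarly for the other three types (Corollary 3.14). -/

import Mathlib

/-- A letter of the alphabet `{X, X⁻¹, Y, Y⁻¹}`. -/
inductive L where
  | X | Xi | Y | Yi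
deriving DecidableEq

/-- A word is a finite sequence of letters. -/
abbrev Word := List L

/-- Whether a letter is an `X`-letter, i.e. `X` or `X⁻¹`. -/
def L.isX : L → Bool
  | .X => true
  | .Xi => true
  | _ => false

/-- The sign of a letter: `+1` for `X`, `-1` for `X⁻¹`, `0` for `Y`-letters. -/
def L.sgn : L → ℤ
  | .X => 1
  | .Xi => -1
  | _ => 0

/-- The formal inverse of a letter. -/
def L.inv : L → L
  | .X => .Xi
  | .Xi => .X
  | .Y => .Yi
  | .Yi => .Y

/-- `phi W` = (number of `X`'s in `W`) - (number of `X⁻¹`'s in `W`). -/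
def phi (w : Word) : ℤ := (w.map L.sgn).sum

/-- The subsequence of `X`-letters `x₁, …, xₙ` of a word. -/
def xLetters (w : Word) : Word := w.filter (·.isX)

/-- The number `n` of `X`-letters of a word. -/
def numX (w : Word) : ℕ := (xLetters w).length

/-- The `i`-th `X`-letter `xᵢ` of a word (1-indexed; junk value `Y` out of range). -/
def xLtr (w : Word) (i : ℕ) : L := (xLetters w).getD (i - 1) L.Y

/-- `phi (W₁ⁱ)`: the sign-sum of the first `i` `X`-letters of `W`. -/
def phiPrefix (w : Word) (i : ℕ) : ℤ := (((xLetters w).take i).map L.sgn).sum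

/-- `W` is a disk word: it has `n ≥ 2` `X`-letters, its first letter is `x₁`,
its last letter is `xₙ`, `x₁` and `xₙ` have opposite signs, and `phi W = 0`. -/
def IsDiskWord (w : Word) : Prop :=
  2 ≤ numX w ∧
  w.head? = (xLetters w).head? ∧
  w.getLast? = (xLetters w).getLast? ∧
  phi w = 0 ∧
  (xLtr w 1).sgn = -(xLtr w (numX w)).sgn

/-- A disk word `W = W₁ⁿ` is primitive if `phi (W₁ᵏ) ≠ 0` for all `1 < k < n`. -/
def IsPrimitive (w : Word) : Prop :=
  IsDiskWord w ∧ ∀ k, 1 < k → k < numX w → phiPrefix w k ≠ 0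

/-- A disk word is upward if `x₁ = X`. -/
def Upward (w : Word) : Prop := xLtr w 1 = L.X

/-- A disk word is downward if `x₁ = X⁻¹`. -/
def Downward (w : Word) : Prop := xLtr w 1 = L.Xi

/-- `eps W i = 1` if `xᵢ` has the same sign as `x₁`, and `0` otherwise. -/
def eps (w : Word) (i : ℕ) : ℤ := if xLtr w i = xLtr w 1 then 1 else 0

/-- The height `h(xᵢ)`: `phi (W₁ⁱ) - eps xᵢ` in the upward case and
`phi (W₁ⁱ) + eps xᵢ` in the downward case. -/
def height (w : Word) (i : ℕ) : ℤ :=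
  if xLtr w 1 = L.X then phiPrefix w i - eps w i else phiPrefix w i + eps w i

/-- A word is reduced if it has no adjacent pair of mutually inverse letters. -/
def Reduced (w : Word) : Prop := w.Chain' (fun a b => b ≠ a.inv)

/-- The (0-indexed) positions in `w` of its `X`-letters. -/
def xPos (w : Word) : List ℕ :=
  (List.range w.length).filter (fun i => (w.getD i L.Y).isX)

/-- `subword w i j` = `Wᵢʲ`, the contiguous subword of `w` from the `i`-th
to the `j`-th `X`-letter (1-indexed, inclusive). -/
def subword (w : Word) (i j : ℕ) : Word :=
  (w.take ((xPos w).getD (j - 1) 0 + 1)).drop ((xPos w).getD (i - 1) 0)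

/-- `Y^m`: `m` copies of `Y` if `m ≥ 0`, `-m` copies of `Y⁻¹` if `m < 0`. -/
def Ypow (m : ℤ) : Word :=
  if 0 ≤ m then List.replicate m.toNat L.Y else List.replicate (-m).toNat L.Yi


/-- `e_Y W` = (number of `Y`'s) - (number of `Y⁻¹`'s) in `W`. -/
def eY (w : Word) : ℤ := (w.count L.Y : ℤ) - (w.count L.Yi : ℤ)

/-- Number of occurrences of the pattern `p` as a contiguous subword of `w`. -/
def countPat (p w : Word) : ℕ :=
  ((List.range w.length).filter (fun i => decide (p <+: w.drop i))).length

/-- Number of positive elementary subwords `X Y⁻¹ X⁻¹` and `X⁻¹ Y X`. -/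
def posElemCount (w : Word) : ℕ :=
  countPat [L.X, L.Yi, L.Xi] w + countPat [L.Xi, L.Y, L.X] w

/-- Number of negative elementary subwords `X Y X⁻¹` and `X⁻¹ Y⁻¹ X`. -/
def negElemCount (w : Word) : ℕ :=
  countPat [L.X, L.Y, L.Xi] w + countPat [L.Xi, L.Yi, L.X] w

/-- A disk word is positive if it has one more positive than negative elementary subword. -/
def PositiveW (w : Word) : Prop := (posElemCount w : ℤ) - (negElemCount w : ℤ) = 1

/-- A disk word is negative if it has one more negative than positive elementary subword. -/
def NegativeW (w : Word) : Prop := (posElemCount w : ℤ) - (negElemCount w : ℤ) = -1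

instance (w : Word) : Decidable (PositiveW w) := by unfold PositiveW; infer_instance
instance (w : Word) : Decidable (NegativeW w) := by unfold NegativeW; infer_instance

/-- `ι_Y`: invert all `Y`-letters. -/
def iotaY (w : Word) : Word :=
  w.map (fun l => match l with | L.Y => L.Yi | L.Yi => L.Y | l => l)

/-- `ι_X`: invert all `X`-letters. -/
def iotaX (w : Word) : Word :=
  w.map (fun l => match l with | L.X => L.Xi | L.Xi => L.X | l => l)

/-- `ι_{XY}`: invert all letters. -/
def iotaXY (w : Word) : Word := w.map L.inv

/-- The increasing list `k₁ < … < k_{d+1}` of indices `i` with `1 < i < n` and `h(xᵢ) = 1`. -/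
def heightOnes (w : Word) : List ℕ :=
  (List.range (numX w)).filter (fun i => decide (1 < i ∧ i < numX w ∧ height w i = 1))

/-- The correction term `Q` in clause (b) of the definition of `P`, determined by
`a = e_Y (W₁²)`, `b = e_Y (W_{n-1}ⁿ)` and the first and last height-one subwords. -/
def Qval (w : Word) : ℤ × ℤ :=
  let a := eY (subword w 1 2)
  let b := eY (subword w (numX w - 1) (numX w))
  let ks := heightOnes w
  if a + b = 1 then (1, 0)
  else if a + b = -1 then (0, 1)
  else if 3 ≤ ks.length ∧ PositiveW (subword w 2 (ks.getD 1 0)) ∧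
      PositiveW (subword w (ks.getD (ks.length - 2) 0) (numX w - 1)) then (1, 1)
  else (0, 0)

/-- The basepoint-counting partial function `P = (n_z, n_w)` on primitive disk words,
encoded as a relation: `PRel w p` holds iff `P` is defined at `w` with value `p`.
Clauses: (a) the four elementary bigons; (b) upward positive words with `n > 2`;
(c) upward negative; (d) downward negative; (e) downward positive (each with `n > 2`,
two-`X`-letter words being covered exactly by (a)). -/
inductive PRel : Word → ℤ × ℤ → Prop where
  | elem1 : PRel [L.X, L.Y, L.Xi] (0, -1)
  | elem2 : PRel [L.X, L.Yi, L.Xi] (0, 1)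
  | elem3 : PRel [L.Xi, L.Y, L.X] (1, 0)
  | elem4 : PRel [L.Xi, L.Yi, L.X] (-1, 0)
  | upPos (w : Word) (ps : List (ℤ × ℤ)) :
      IsPrimitive w → Upward w → PositiveW w → 2 < numX w →
      |eY (subword w 1 2) + eY (subword w (numX w - 1) (numX w))| ≤ 1 →
      ps.length + 1 = (heightOnes w).length →
      (∀ i, i + 1 < (heightOnes w).length →
        PRel (subword w ((heightOnes w).getD i 0) ((heightOnes w).getD (i + 1) 0))
          (ps.getD i 0)) →
      PRel w (Qval w + ps.sum)
  | upNeg (w : Word) (v : ℤ × ℤ) :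
      IsPrimitive w → Upward w → NegativeW w → 2 < numX w →
      PRel (iotaY w) v → PRel w (-v)
  | downNeg (w : Word) (v : ℤ × ℤ) :
      IsPrimitive w → Downward w → NegativeW w → 2 < numX w →
      PRel (iotaX w) v → PRel w (-v.2, -v.1)
  | downPos (w : Word) (v : ℤ × ℤ) :
      IsPrimitive w → Downward w → PositiveW w → 2 < numX w →
      PRel (iotaXY w) v → PRel w (v.2, v.1)

/-- The word `aᵏ b cᵏ`. -/
def hill (a b c : L) (k : ℕ) : Word := List.replicate k a ++ b :: List.replicate k c

lemma hill_succ (a b c : L) (k : ℕ) : hill a b c (k + 1) = a :: (hill a b c k ++ [c]) := by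
  simp [hill, List.replicate_succ, ← List.replicate_succ']

lemma length_hill (a b c : L) (k : ℕ) : (hill a b c k).length = 2 * k + 1 := by
  simp [hill]; ring

section

variable {a b c : L}

lemma xLetters_hill (ha : a.isX = true) (hb : b.isX = false) (hc : c.isX = true) (k : ℕ) :
    xLetters (hill a b c k) = List.replicate k a ++ List.replicate k c := by
  simp [xLetters, hill, List.filter_append, ha, hb, hc]

lemma numX_hill (ha : a.isX = true) (hb : b.isX = false) (hc : c.isX = true) (k : ℕ) :
    numX (hill a b c k) = 2 * k := by
  simp [numX, xLetters_hill ha hb hc]; ring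

lemma xLtr_hill (ha : a.isX = true) (hb : b.isX = false) (hc : c.isX = true) {k i : ℕ}
    (hi : 1 ≤ i) (hik : i ≤ 2 * k) :
    xLtr (hill a b c k) i = if i ≤ k then a else c := by
  rw [xLtr, xLetters_hill ha hb hc, List.getD_eq_getElem _ _ (by simp; omega),
    List.getElem_append]
  simp only [List.length_replicate, List.getElem_replicate]
  split_ifs <;> first | rfl | omega

lemma phiPrefix_hill (ha : a.isX = true) (hb : b.isX = false) (hc : c.isX = true) {k i : ℕ}
    (hik : i ≤ 2 * k) :
    phiPrefix (hill a b c k) i = (min i k : ℕ) * a.sgn + (i - k : ℕ) * c.sgn := by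
  have : min (i - k) k = i - k := by omega
  simp [phiPrefix, xLetters_hill ha hb hc, List.take_append, this]

lemma isPrimitive_hill (ha : a.isX = true) (hb : b.isX = false) (hc : c.isX = true)
    (hac : a.sgn = -c.sgn) {k : ℕ} (hk : 1 ≤ k) : IsPrimitive (hill a b c k) := by
  refine ⟨⟨?_, ?_, ?_, ?_, ?_⟩, fun i hi hin => ?_⟩
  · rw [numX_hill ha hb hc]; omega
  · obtain ⟨j, rfl⟩ := Nat.exists_eq_add_of_le' hk
    rw [xLetters_hill ha hb hc]
    simp [hill, List.replicate_succ]
  · obtain ⟨j, rfl⟩ := Nat.exists_eq_add_of_le' hk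
    rw [xLetters_hill ha hb hc, hill_succ, List.replicate_succ' (a := c), ← List.append_assoc,
      ← List.cons_append, List.getLast?_concat, List.getLast?_concat]
  · simp [phi, hill, hac]
    cases b <;> simp_all [L.isX, L.sgn]
  · rw [numX_hill ha hb hc, xLtr_hill ha hb hc le_rfl (by omega),
      xLtr_hill ha hb hc (by omega) le_rfl, if_pos hk, if_neg (by omega), hac]
  · rw [numX_hill ha hb hc] at hin
    rw [phiPrefix_hill ha hb hc hin.le, hac]
    have : c.sgn = 1 ∨ c.sgn = -1 := by cases c <;> simp_all [L.isX, L.sgn]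
    rcases this with h | h <;> rw [h] <;> omega

end

lemma countPat_cons (p : Word) (x : L) (w : Word) :
    countPat p (x :: w) = (if p <+: x :: w then 1 else 0) + countPat p w := by
  simp only [countPat, List.length_cons, List.range_succ_eq_map, List.filter_cons,
    List.filter_map, List.drop_zero]
  split_ifs <;> simp_all [Function.comp_def, add_comm]

lemma countPat_eq_zero_of_notMem {p w : Word} {y : L} (hp : y ∈ p) (hw : y ∉ w) :
    countPat p w = 0 := by
  simp only [countPat, List.length_eq_zero_iff, List.filter_eq_nil_iff, decide_eq_true_eq]
  exact fun i _ h => hw (List.mem_of_mem_drop (h.subset hp))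

lemma countPat_hill {a b c p q r : L} (hp : p.isX = true) (hq : q.isX = false)
    (ha : a.isX = true) (hb : b.isX = false) (hc : c.isX = true) {k : ℕ} (hk : 1 ≤ k) :
    countPat [p, q, r] (hill a b c k) = if p = a ∧ q = b ∧ r = c then 1 else 0 := by
  have hqa : q ≠ a := by rintro rfl; simp_all
  have hqc : q ≠ c := by rintro rfl; simp_all
  have hpb : p ≠ b := by rintro rfl; simp_all
  have key (j l : ℕ) : countPat [p, q, r] (List.replicate (j + 1) a ++ b ::
      List.replicate (l + 1) c) = if p = a ∧ q = b ∧ r = c then 1 else 0 := by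
    induction j with
    | zero =>
      have h0 : countPat [p, q, r] (List.replicate (l + 1) c) = 0 :=
        countPat_eq_zero_of_notMem (y := q) (by simp) (by simp [hqc])
      simp only [zero_add, List.replicate_one, List.singleton_append, countPat_cons, h0]
      simp [hpb, List.replicate_succ]
    | succ j ih =>
      rw [List.replicate_succ, List.cons_append, countPat_cons, ih]
      simp [List.replicate_succ, hqa]
  obtain ⟨j, rfl⟩ := Nat.exists_eq_add_of_le' hk
  exact key j j

lemma posElemCount_hill {a b c : L} (ha : a.isX = true) (hb : b.isX = false) (hc : c.isX = true)
    {k : ℕ} (hk : 1 ≤ k) :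
    posElemCount (hill a b c k) = (if L.X = a ∧ L.Yi = b ∧ L.Xi = c then 1 else 0) +
      if L.Xi = a ∧ L.Y = b ∧ L.X = c then 1 else 0 := by
  rw [posElemCount, countPat_hill rfl rfl ha hb hc hk, countPat_hill rfl rfl ha hb hc hk]

lemma negElemCount_hill {a b c : L} (ha : a.isX = true) (hb : b.isX = false) (hc : c.isX = true)
    {k : ℕ} (hk : 1 ≤ k) :
    negElemCount (hill a b c k) = (if L.X = a ∧ L.Y = b ∧ L.Xi = c then 1 else 0) +
      if L.Xi = a ∧ L.Yi = b ∧ L.X = c then 1 else 0 := by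
  rw [negElemCount, countPat_hill rfl rfl ha hb hc hk, countPat_hill rfl rfl ha hb hc hk]

lemma xPos_hill {a b c : L} (ha : a.isX = true) (hb : b.isX = false) (hc : c.isX = true)
    (k : ℕ) : xPos (hill a b c k) = List.range k ++ List.range' (k + 1) k := by
  refine (List.pairwise_lt_range.filter _).eq_of_mem_iff ?_ fun {i} => ?_
  · refine List.pairwise_append.2 ⟨List.pairwise_lt_range, List.pairwise_lt_range', ?_⟩
    intro x hx y hy
    simp at hx hy
    omega
  · simp only [List.mem_filter, List.mem_range, length_hill, List.mem_append,
      List.mem_range'_1]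
    by_cases hi : i < 2 * k + 1
    · rw [List.getD_eq_getElem _ _ (by rw [length_hill]; exact hi)]
      simp only [hill, List.getElem_append, List.getElem_cons, List.length_replicate,
        List.getElem_replicate]
      split_ifs <;> simp_all <;> omega
    · simp [hi]; omega

lemma getD_xPos_hill {a b c : L} (ha : a.isX = true) (hb : b.isX = false) (hc : c.isX = true)
    {k i : ℕ} (hi : i < 2 * k) :
    (xPos (hill a b c k)).getD i 0 = if i < k then i else i + 1 := by
  rw [xPos_hill ha hb hc, List.getD_eq_getElem _ _ (by simp; omega), List.getElem_append]
  simp only [List.length_range, List.getElem_range, List.getElem_range']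
  split_ifs <;> omega

lemma heightOnes_hill {b : L} (hb : b.isX = false) {k : ℕ} (hk : 2 ≤ k) :
    heightOnes (hill L.X b L.Xi k) = [2, 2 * k - 1] := by
  refine (List.pairwise_lt_range.filter _).eq_of_mem_iff (by simp; omega) fun {i} => ?_
  simp only [List.mem_filter, List.mem_range, numX_hill (a := L.X) (c := L.Xi) rfl hb
    rfl, decide_eq_true_eq, List.mem_cons, List.not_mem_nil, or_false]
  by_cases hi : 1 < i ∧ i < 2 * k
  · have h1 : xLtr (hill L.X b L.Xi k) 1 = L.X := by
      rw [xLtr_hill rfl hb rfl le_rfl (by omega), if_pos (by omega)]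
    rw [height, eps, if_pos h1, h1, phiPrefix_hill rfl hb rfl (by omega),
      xLtr_hill rfl hb rfl (by omega) (by omega)]
    simp only [L.sgn]
    by_cases h : i ≤ k <;> simp only [h, if_true, if_false, reduceCtorEq] <;> omega
  · omega

lemma subword_hill {a b c : L} (ha : a.isX = true) (hb : b.isX = false) (hc : c.isX = true)
    {k : ℕ} (hk : 1 ≤ k) :
    subword (hill a b c (k + 1)) 2 (2 * (k + 1) - 1) = hill a b c k := by
  rw [subword, getD_xPos_hill ha hb hc (i := 2 * (k + 1) - 1 - 1) (by omega),
    getD_xPos_hill ha hb hc (i := 2 - 1) (by omega), if_pos (by omega), if_neg (by omega),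
    hill_succ, show 2 * (k + 1) - 1 - 1 + 1 + 1 = (2 * k + 1) + 1 by omega, List.take_succ_cons,
    List.take_left' (length_hill ..)]
  rfl

lemma eY_subword_hill_first {a b c : L} (ha : a.isX = true) (hb : b.isX = false)
    (hc : c.isX = true) {k : ℕ} (hk : 2 ≤ k) : eY (subword (hill a b c k) 1 2) = 0 := by
  rw [subword, getD_xPos_hill ha hb hc (by omega), getD_xPos_hill ha hb hc (by omega),
    if_pos (by omega), if_pos (by omega)]
  obtain ⟨j, rfl⟩ := Nat.exists_eq_add_of_le' hk
  cases a <;> simp_all [hill, List.replicate_succ, eY, L.isX]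

lemma eY_subword_hill_last {a b c : L} (ha : a.isX = true) (hb : b.isX = false)
    (hc : c.isX = true) {k : ℕ} (hk : 2 ≤ k) :
    eY (subword (hill a b c k) (2 * k - 1) (2 * k)) = 0 := by
  have h : subword (hill a b c k) (2 * k - 1) (2 * k) = [c, c] := by
    rw [subword, getD_xPos_hill ha hb hc (by omega), getD_xPos_hill ha hb hc (by omega),
      if_neg (by omega), if_neg (by omega), List.take_of_length_le (by rw [length_hill]; omega)]
    obtain ⟨j, rfl⟩ := Nat.exists_eq_add_of_le' hk
    have : hill a b c (j + 2) = (a :: a :: hill a b c j) ++ [c, c] := by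
      simp [hill_succ]
    rw [this]
    exact List.drop_left' (by simp [length_hill]; omega)
  rw [h]
  cases c <;> simp_all [eY, L.isX]

lemma PRel_hill_X_Yi_Xi {k : ℕ} (hk : 1 ≤ k) : PRel (hill L.X L.Yi L.Xi k) (0, 1) := by
  induction k, hk using Nat.le_induction with
  | base => exact PRel.elem2
  | succ k hk ih =>
    have hn : numX (hill L.X L.Yi L.Xi (k + 1)) = 2 * (k + 1) := numX_hill rfl rfl rfl _
    have hh : heightOnes (hill L.X L.Yi L.Xi (k + 1)) = [2, 2 * (k + 1) - 1] :=
      heightOnes_hill rfl (by omega)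
    have he₁ : eY (subword (hill L.X L.Yi L.Xi (k + 1)) 1 2) = 0 :=
      eY_subword_hill_first rfl rfl rfl (by omega)
    have he₂ : eY (subword (hill L.X L.Yi L.Xi (k + 1)) (2 * (k + 1) - 1) (2 * (k + 1))) = 0 :=
      eY_subword_hill_last rfl rfl rfl (by omega)
    have hQ : Qval (hill L.X L.Yi L.Xi (k + 1)) = 0 := by
      simp only [Qval, hn, hh, he₁, he₂]
      simp
    have key := PRel.upPos (hill L.X L.Yi L.Xi (k + 1)) [(0, 1)]
      (isPrimitive_hill rfl rfl rfl rfl (by omega))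
      (by rw [Upward, xLtr_hill rfl rfl rfl le_rfl (by omega), if_pos (by omega)])
      (by rw [PositiveW, posElemCount_hill rfl rfl rfl (Nat.le_add_left 1 k),
          negElemCount_hill rfl rfl rfl (Nat.le_add_left 1 k)]; simp)
      (by omega) (by rw [hn, he₁, he₂]; simp) (by rw [hh]; rfl) (by
        intro i hi
        rw [hh] at hi ⊢
        obtain rfl : i = 0 := by simp at hi; omega
        simpa [subword_hill (a := L.X) (b := L.Yi) (c := L.Xi) rfl rfl rfl hk] using ih)
    simpa [hQ] using key

/-- for every `k ≥ 1`, the words `Xᵏ Y X⁻ᵏ`, `Xᵏ Y⁻¹ X⁻ᵏ`, `X⁻ᵏ Y Xᵏ`,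
`X⁻ᵏ Y⁻¹ Xᵏ` are primitive disk words in the domain of `P`, with
`P(Xᵏ Y X⁻ᵏ) = (0,-1)`, `P(Xᵏ Y⁻¹ X⁻ᵏ) = (0,1)`, `P(X⁻ᵏ Y Xᵏ) = (1,0)`,
`P(X⁻ᵏ Y⁻¹ Xᵏ) = (-1,0)`; in particular these agree with the values on the
four elementary bigons. -/
theorem P_on_powers_of_elementary (k : ℕ) (hk : 1 ≤ k) :
    (IsPrimitive (List.replicate k L.X ++ L.Y :: List.replicate k L.Xi) ∧
      PRel (List.replicate k L.X ++ L.Y :: List.replicate k L.Xi) (0, -1)) ∧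
    (IsPrimitive (List.replicate k L.X ++ L.Yi :: List.replicate k L.Xi) ∧
      PRel (List.replicate k L.X ++ L.Yi :: List.replicate k L.Xi) (0, 1)) ∧
    (IsPrimitive (List.replicate k L.Xi ++ L.Y :: List.replicate k L.X) ∧
      PRel (List.replicate k L.Xi ++ L.Y :: List.replicate k L.X) (1, 0)) ∧
    (IsPrimitive (List.replicate k L.Xi ++ L.Yi :: List.replicate k L.X) ∧
      PRel (List.replicate k L.Xi ++ L.Yi :: List.replicate k L.X) (-1, 0)) := by
  have h2 := PRel_hill_X_Yi_Xi hk
  have h1 : PRel (hill L.X L.Y L.Xi k) (0, -1) := by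
    obtain rfl | hk' := hk.eq_or_lt
    · exact PRel.elem1
    · exact PRel.upNeg _ (0, 1) (isPrimitive_hill rfl rfl rfl rfl hk)
        (by rw [Upward, xLtr_hill rfl rfl rfl le_rfl (by omega), if_pos hk])
        (by rw [NegativeW, posElemCount_hill rfl rfl rfl hk,
          negElemCount_hill rfl rfl rfl hk]; simp)
        (by rw [numX_hill rfl rfl rfl]; omega)
        (by simpa [iotaY, hill] using h2)
  have h3 : PRel (hill L.Xi L.Y L.X k) (1, 0) := by
    obtain rfl | hk' := hk.eq_or_lt
    · exact PRel.elem3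
    · exact PRel.downPos _ (0, 1) (isPrimitive_hill rfl rfl rfl rfl hk)
        (by rw [Downward, xLtr_hill rfl rfl rfl le_rfl (by omega), if_pos hk])
        (by rw [PositiveW, posElemCount_hill rfl rfl rfl hk,
          negElemCount_hill rfl rfl rfl hk]; simp)
        (by rw [numX_hill rfl rfl rfl]; omega)
        (by simpa [iotaXY, hill, L.inv] using h2)
  have h4 : PRel (hill L.Xi L.Yi L.X k) (-1, 0) := by
    obtain rfl | hk' := hk.eq_or_lt
    · exact PRel.elem4
    · exact PRel.downNeg _ (0, 1) (isPrimitive_hill rfl rfl rfl rfl hk)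
        (by rw [Downward, xLtr_hill rfl rfl rfl le_rfl (by omega), if_pos hk])
        (by rw [NegativeW, posElemCount_hill rfl rfl rfl hk,
          negElemCount_hill rfl rfl rfl hk]; simp)
        (by rw [numX_hill rfl rfl rfl]; omega)
        (by simpa [iotaX, hill] using h2)
  exact ⟨⟨isPrimitive_hill rfl rfl rfl rfl hk, h1⟩, ⟨isPrimitive_hill rfl rfl rfl rfl hk, h2⟩,
    ⟨isPrimitive_hill rfl rfl rfl rfl hk, h3⟩, ⟨isPrimitive_hill rfl rfl rfl rfl hk, h4⟩⟩
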